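/- For every n ∈ ℤ⁺, every admissible α, every t ∈ [0,1], and every k ∈ ℤ⁺, the average velocity of the quantum walk U_{t,n} = D_n·U_t over the first nk steps satisfies (1/(nk))·‖[X, U_{t,n}^{nk}]‖ ≤ (3/4)·(4t)^n. -/

import Mathlib

noncomputable section

abbrev Hqw : Type := lp (fun _ : ℤ => ℂ) 2
abbrev Op : Type := Hqw →L[ℂ] Hqw

noncomputable def δ (j : ℤ) : Hqw := lp.single 2 j 1

def coord (ψ : Hqw) (i : ℤ) : ℂ := ψ i

/-- `B δ_j = δ_{j-1} - δ_{j+1}`. -/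
def IsB (B : Op) : Prop := ∀ j : ℤ, B (δ j) = δ (j - 1) - δ (j + 1)

/-- `C δ_{2j} = δ_{2j+2}`, `C δ_{2j+1} = δ_{2j-1}`. -/
def IsC (C : Op) : Prop :=
  ∀ j : ℤ, C (δ (2 * j)) = δ (2 * j + 2) ∧ C (δ (2 * j + 1)) = δ (2 * j - 1)

/-- the position sequence: `x_{2j} = x_{2j+1} = |j|`. -/
def IsPos (x : ℤ → ℝ) : Prop :=
  ∀ j : ℤ, x (2 * j) = |(j : ℝ)| ∧ x (2 * j + 1) = |(j : ℝ)|

/-- `K` is the commutator `[X, A]`, i.e. `⟨δ_i, K δ_j⟩ = (x_i - x_j) ⟨δ_i, A δ_j⟩`. -/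
def IsXComm (x : ℤ → ℝ) (A K : Op) : Prop :=
  ∀ i j : ℤ, coord (K (δ j)) i = ((x i - x j : ℝ) : ℂ) * coord (A (δ j)) i

/-- a local field: a diagonal unitary `D δ_j = e^{iθ_j} δ_j`. -/
def IsLocalField (D : Op) : Prop :=
  ∃ θ : ℤ → ℝ, ∀ j : ℤ, D (δ j) = Complex.exp ((θ j : ℂ) * Complex.I) • δ j

/-- `U_t = r² I + r t B + t² C` with `r = √(1 - t²)`. -/
def Ut (t : ℝ) (B C : Op) : Op :=
  (((Real.sqrt (1 - t ^ 2)) ^ 2 : ℝ) : ℂ) • (1 : Op) +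
    ((Real.sqrt (1 - t ^ 2) * t : ℝ) : ℂ) • B + ((t ^ 2 : ℝ) : ℂ) • C

/-- `⟨X⟩_ψ = Σ_j x_j |⟨δ_j, ψ⟩|²`. -/
def Xexp (x : ℤ → ℝ) (ψ : Hqw) : ℝ := ∑' j : ℤ, x j * ‖coord ψ j‖ ^ 2

/-- a unit vector supported on `span{δ₀, δ₁}`. -/
def IsInit (Ψ : Hqw) : Prop := ‖Ψ‖ = 1 ∧ ∃ a b : ℂ, Ψ = a • δ 0 + b • δ 1

/-- `α = e^{2πik/n}` with `k ∈ ℤ⁺`, `gcd(k,n) = 1`, `α ≠ 1`. -/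
def IsAdmissible (n : ℕ) (α : ℂ) : Prop :=
  α ≠ 1 ∧ ∃ k : ℕ, 0 < k ∧ Nat.gcd k n = 1 ∧
    α = Complex.exp (((2 * Real.pi * k / n : ℝ) : ℂ) * Complex.I)

/-- the `n`-periodic field `D_n δ_j = α^j δ_j`. -/
def IsDn (α : ℂ) (D : Op) : Prop := ∀ j : ℤ, D (δ j) = α ^ j • δ j

/-- `B^{(j)} = D_n^j B D_n^{-j}`, explicitly `B^{(j)} δ_i = α^{-j} δ_{i-1} - α^{j} δ_{i+1}`. -/
def IsBj (α : ℂ) (j : ℤ) (Bj : Op) : Prop :=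
  ∀ i : ℤ, Bj (δ i) = α ^ (-j) • δ (i - 1) - α ^ j • δ (i + 1)

/-- `C^{(j)} = D_n^j C D_n^{-j}`, explicitly `C^{(j)} δ_{2i} = α^{2j} δ_{2i+2}`,
`C^{(j)} δ_{2i+1} = α^{-2j} δ_{2i-1}`. -/
def IsCj (α : ℂ) (j : ℤ) (Cj : Op) : Prop :=
  ∀ i : ℤ, Cj (δ (2 * i)) = α ^ (2 * j) • δ (2 * i + 2) ∧
    Cj (δ (2 * i + 1)) = α ^ (-(2 * j)) • δ (2 * i - 1)

-- the elementary symmetric polynomial of operators `S^{ℓ,m}_{[a, n-1]}`: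
-- sum over `a ≤ j₁ < … < j_ℓ ≤ n-1` and `η ∈ {0,1}^ℓ` with `|η| = m` of the ordered
-- products `A_{η₁}^{(j₁)} ⋯ A_{η_ℓ}^{(j_ℓ)}`, where `A_1 = C`, `A_0 = B`.
open Classical in
noncomputable def Sop (Bf Cf : ℤ → Op) (a n ℓ m : ℕ) : Op :=
  ∑ p : (Fin ℓ → Fin n) × (Fin ℓ → Bool),
    if StrictMono p.1 ∧ (∀ k, a ≤ (p.1 k : ℕ)) ∧
        (Finset.univ.filter fun k => p.2 k = true).card = m then
      (List.ofFn fun k : Fin ℓ =>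
        if p.2 k = true then Cf ((p.1 k : ℕ) : ℤ) else Bf ((p.1 k : ℕ) : ℤ)).prod
    else 0

/-! ### Basic facts -/

theorem coord_δ (j i : ℤ) : coord (δ j) i = if i = j then 1 else 0 := by
  unfold coord δ
  rw [lp.single_apply, Pi.single_apply]

theorem coord_add (ψ φ : Hqw) (i : ℤ) : coord (ψ + φ) i = coord ψ i + coord φ i := rfl
theorem coord_smul (c : ℂ) (ψ : Hqw) (i : ℤ) : coord (c • ψ) i = c * coord ψ i := rfl
theorem coord_zero (i : ℤ) : coord 0 i = 0 := rfl

theorem op_add (A A' : Op) (ψ : Hqw) : (A + A') ψ = A ψ + A' ψ := rfl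
theorem op_smul (c : ℂ) (A : Op) (ψ : Hqw) : (c • A) ψ = c • A ψ := rfl
theorem op_zero (ψ : Hqw) : (0 : Op) ψ = 0 := rfl
theorem op_one (ψ : Hqw) : (1 : Op) ψ = ψ := rfl
theorem op_mul (A A' : Op) (ψ : Hqw) : (A * A') ψ = A (A' ψ) := rfl
theorem norm_op_one : ‖(1 : Op)‖ ≤ 1 := ContinuousLinearMap.norm_id_le

theorem coord_ext {ψ φ : Hqw} (h : ∀ i, coord ψ i = coord φ i) : ψ = φ := by
  apply lp.ext
  funext i
  exact h i

theorem hasSum_δ (ψ : Hqw) : HasSum (fun k => coord ψ k • δ k) ψ := by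
  have h := lp.hasSum_single (p := 2) (by simp) ψ
  convert! h using 2 with k
  apply coord_ext
  intro i
  rw [coord_smul, coord_δ]
  unfold coord
  rw [lp.single_apply, Pi.single_apply]
  split_ifs with h
  · subst h; simp
  · simp

theorem op_ext {A A' : Op} (h : ∀ j, A (δ j) = A' (δ j)) : A = A' := by
  apply ContinuousLinearMap.ext
  intro ψ
  have h1 := (hasSum_δ ψ).mapL A
  have h2 := (hasSum_δ ψ).mapL A'
  simp only [map_smul, h] at h1 h2
  exact h1.unique h2

theorem hasSum_coord (A : Op) (ψ : Hqw) (i : ℤ) :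
    HasSum (fun k => coord ψ k * coord (A (δ k)) i) (coord (A ψ) i) := by
  have h1 := ((hasSum_δ ψ).mapL A).mapL (lp.evalCLM ℂ (fun _ : ℤ => ℂ) 2 i)
  simp only [map_smul] at h1
  exact h1

theorem isXComm_unique {x : ℤ → ℝ} {A K K' : Op} (h : IsXComm x A K) (h' : IsXComm x A K') :
    K = K' := by
  apply op_ext
  intro j
  apply coord_ext
  intro i
  rw [h i j, h' i j]

theorem isXComm_add {x : ℤ → ℝ} {A K A' K' : Op} (h : IsXComm x A K) (h' : IsXComm x A' K') :
    IsXComm x (A + A') (K + K') := by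
  intro i j
  simp only [op_add, coord_add, h i j, h' i j]
  ring

theorem isXComm_smul {x : ℤ → ℝ} {A K : Op} (c : ℂ) (h : IsXComm x A K) :
    IsXComm x (c • A) (c • K) := by
  intro i j
  simp only [op_smul, coord_smul, h i j]
  ring

theorem isXComm_zero (x : ℤ → ℝ) : IsXComm x 0 0 := by
  intro i j
  simp [coord_zero]

theorem isXComm_one (x : ℤ → ℝ) : IsXComm x 1 0 := by
  intro i j
  simp only [op_zero, op_one, coord_zero, coord_δ]
  split_ifs with h
  · simp [h]
  · simp

theorem isXComm_mul {x : ℤ → ℝ} {A K A' K' : Op} (h : IsXComm x A K) (h' : IsXComm x A' K') :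
    IsXComm x (A * A') (K * A' + A * K') := by
  intro i j
  simp only [op_add, op_mul, coord_add]
  have h1 := hasSum_coord K (A' (δ j)) i
  have h2 := hasSum_coord A (K' (δ j)) i
  have h3 := (hasSum_coord A (A' (δ j)) i).mul_left ((x i - x j : ℝ) : ℂ)
  refine (h1.add h2).unique ?_
  have e : (fun k => coord (A' (δ j)) k * coord (K (δ k)) i + coord (K' (δ j)) k * coord (A (δ k)) i)
      = fun k => ((x i - x j : ℝ) : ℂ) * (coord (A' (δ j)) k * coord (A (δ k)) i) := by
    funext k
    rw [h i k, h' k j]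
    push_cast
    ring
  rw [e]
  exact h3

theorem isXComm_sum {x : ℤ → ℝ} {ι : Type} (s : Finset ι) (A K : ι → Op)
    (h : ∀ a, IsXComm x (A a) (K a)) : IsXComm x (∑ a ∈ s, A a) (∑ a ∈ s, K a) := by
  classical
  induction s using Finset.induction_on with
  | empty => simpa using isXComm_zero x
  | insert a s ha ih =>
    rw [Finset.sum_insert ha, Finset.sum_insert ha]
    exact isXComm_add (h a) ih

theorem norm_op_pow {A : Op} (hA : ‖A‖ ≤ 1) (k : ℕ) : ‖A ^ k‖ ≤ 1 := by
  induction k with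
  | zero => simpa using norm_op_one
  | succ k ih =>
    rw [pow_succ]
    exact (norm_mul_le _ _).trans (mul_le_one₀ ih (norm_nonneg _) hA)

theorem isXComm_pow {x : ℤ → ℝ} {A K : Op} (h : IsXComm x A K) (hA : ‖A‖ ≤ 1) (k : ℕ) :
    ∃ K' : Op, IsXComm x (A ^ k) K' ∧ ‖K'‖ ≤ k * ‖K‖ := by
  induction k with
  | zero => exact ⟨0, by simpa using isXComm_one x, by simp⟩
  | succ k ih =>
    obtain ⟨K', h1, h2⟩ := ih
    refine ⟨_, by rw [pow_succ]; exact isXComm_mul h1 h, ?_⟩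
    have hp : ‖A ^ k‖ ≤ 1 := norm_op_pow hA k
    calc ‖K' * A + A ^ k * K‖ ≤ ‖K'‖ * ‖A‖ + ‖A ^ k‖ * ‖K‖ :=
          (norm_add_le _ _).trans (add_le_add (norm_mul_le _ _) (norm_mul_le _ _))
      _ ≤ (k * ‖K‖) * 1 + 1 * ‖K‖ := by gcongr
      _ = _ := by push_cast; ring

/-- Weighted permutation operators. -/
theorem exists_wperm (τ : Equiv.Perm ℤ) (v : ℤ → ℂ) (hv : ∀ j, ‖v j‖ ≤ 1) :
    ∃ M : Op, (∀ j, M (δ j) = v j • δ (τ j)) ∧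
      (∀ ψ i, coord (M ψ) (τ i) = v i * coord ψ i) ∧ ‖M‖ ≤ 1 := by
  have h2 : (0 : ℝ) < (2 : ENNReal).toReal := by simp
  have hs : ∀ ψ : Hqw, Summable fun i => ‖coord ψ (τ.symm i)‖ ^ (2 : ENNReal).toReal := by
    intro ψ
    exact (τ.symm.summable_iff (f := fun i => ‖coord ψ i‖ ^ (2 : ENNReal).toReal)).2
      ((lp.memℓp ψ).summable h2)
  have hle : ∀ (ψ : Hqw) i, ‖v (τ.symm i) * coord ψ (τ.symm i)‖ ^ (2 : ENNReal).toReal ≤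
      ‖coord ψ (τ.symm i)‖ ^ (2 : ENNReal).toReal := by
    intro ψ i
    gcongr
    rw [norm_mul]
    exact mul_le_of_le_one_left (norm_nonneg _) (hv _)
  have hs' : ∀ ψ : Hqw, Summable fun i =>
      ‖v (τ.symm i) * coord ψ (τ.symm i)‖ ^ (2 : ENNReal).toReal := fun ψ =>
    Summable.of_nonneg_of_le (fun i => by positivity) (hle ψ) (hs ψ)
  let f : Hqw →ₗ[ℂ] Hqw :=
    { toFun := fun ψ => ⟨fun i => v (τ.symm i) * coord ψ (τ.symm i), memℓp_gen (hs' ψ)⟩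
      map_add' := by
        intro ψ φ
        apply coord_ext
        intro i
        exact mul_add _ _ _
      map_smul' := by
        intro c ψ
        apply coord_ext
        intro i
        exact mul_left_comm _ _ _ }
  have hf : ∀ ψ i, coord (f ψ) i = v (τ.symm i) * coord ψ (τ.symm i) := fun ψ i => rfl
  have hb : ∀ ψ, ‖f ψ‖ ≤ 1 * ‖ψ‖ := by
    intro ψ
    rw [one_mul]
    apply lp.norm_le_of_tsum_le h2 (norm_nonneg _)
    calc ∑' i, ‖(f ψ) i‖ ^ (2 : ENNReal).toReal
        ≤ ∑' i, ‖coord ψ (τ.symm i)‖ ^ (2 : ENNReal).toReal :=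
          (hs' ψ).tsum_le_tsum (hle ψ) (hs ψ)
      _ = ∑' i, ‖coord ψ i‖ ^ (2 : ENNReal).toReal :=
          τ.symm.tsum_eq (fun i => ‖coord ψ i‖ ^ (2 : ENNReal).toReal)
      _ = ‖ψ‖ ^ (2 : ENNReal).toReal := (lp.norm_rpow_eq_tsum h2 ψ).symm
  refine ⟨f.mkContinuous 1 hb, ?_, ?_, LinearMap.mkContinuous_norm_le _ zero_le_one _⟩
  · intro j
    apply coord_ext
    intro i
    rw [LinearMap.mkContinuous_apply, hf, coord_smul, coord_δ, coord_δ]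
    by_cases h : i = τ j
    · subst h; simp
    · have h' : τ.symm i ≠ j := fun h' => h (by rw [← h']; simp)
      simp [h, h']
  · intro ψ i
    rw [LinearMap.mkContinuous_apply, hf]
    simp

/-! ### Noncommutative elementary symmetric polynomials -/

/-- coefficient of `s^p` in `(1 + s A 0) ⋯ (1 + s A (m-1))`. -/
def esf (A : ℕ → Op) : ℕ → ℕ → Op
  | 0, 0 => 1
  | 0, _ + 1 => 0
  | m + 1, 0 => esf A m 0
  | m + 1, p + 1 => esf A m (p + 1) + esf A m p * A m

/-- its derivation. -/
def desf (A dA : ℕ → Op) : ℕ → ℕ → Op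
  | 0, _ => 0
  | m + 1, 0 => desf A dA m 0
  | m + 1, p + 1 => desf A dA m (p + 1) + (desf A dA m p * A m + esf A m p * dA m)

theorem esf_zero (A : ℕ → Op) (m : ℕ) : esf A m 0 = 1 := by
  induction m with
  | zero => rfl
  | succ m ih => exact ih

theorem esf_left (A : ℕ → Op) (m : ℕ) : ∀ p, esf A (m + 1) (p + 1) =
    esf (fun k => A (k + 1)) m (p + 1) + A 0 * esf (fun k => A (k + 1)) m p := by
  induction m with
  | zero =>
    intro p
    cases p <;> simp [esf]
  | succ m ih =>
    intro p
    rw [esf, ih p]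
    cases p with
    | zero =>
      simp only [esf, esf_zero]
      simp only [mul_one, one_mul]
      abel
    | succ p =>
      rw [ih p]
      simp only [esf]
      noncomm_ring

theorem esf_gt (A : ℕ → Op) (m : ℕ) : ∀ p, m < p → esf A m p = 0 := by
  induction m with
  | zero =>
    intro p hp
    obtain ⟨p, rfl⟩ := Nat.exists_eq_succ_of_ne_zero (by omega : p ≠ 0)
    rfl
  | succ m ih =>
    intro p hp
    obtain ⟨p, rfl⟩ := Nat.exists_eq_succ_of_ne_zero (by omega : p ≠ 0)
    rw [Nat.succ_eq_add_one, esf, ih _ (by omega), ih _ (by omega)]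
    simp

theorem esf_norm (A : ℕ → Op) (hA : ∀ k, ‖A k‖ ≤ 1) (m : ℕ) :
    ∀ p, ‖esf A m p‖ ≤ (m.choose p : ℝ) := by
  induction m with
  | zero =>
    intro p
    cases p with
    | zero => simpa [esf] using norm_op_one
    | succ p => simp [esf]
  | succ m ih =>
    intro p
    cases p with
    | zero => simpa [esf] using ih 0
    | succ p =>
      rw [esf, Nat.choose_succ_succ']
      calc ‖esf A m (p + 1) + esf A m p * A m‖
          ≤ ‖esf A m (p + 1)‖ + ‖esf A m p‖ * ‖A m‖ :=
            (norm_add_le _ _).trans (add_le_add le_rfl (norm_mul_le _ _))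
        _ ≤ (m.choose (p + 1)) + (m.choose p) * 1 := by
            gcongr
            · exact ih _
            · exact ih _
            · exact hA _
        _ = _ := by push_cast; ring

theorem desf_zero (A dA : ℕ → Op) (m : ℕ) : desf A dA m 0 = 0 := by
  induction m with
  | zero => rfl
  | succ m ih => exact ih

theorem desf_comm (x : ℤ → ℝ) (A dA : ℕ → Op) (h : ∀ k, IsXComm x (A k) (dA k)) (m : ℕ) :
    ∀ p, IsXComm x (esf A m p) (desf A dA m p) := by
  induction m with
  | zero =>
    intro p
    cases p with
    | zero => exact isXComm_one x
    | succ p => exact isXComm_zero x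
  | succ m ih =>
    intro p
    cases p with
    | zero => exact ih 0
    | succ p => exact isXComm_add (ih _) (isXComm_mul (ih _) (h m))

theorem desf_norm (A dA : ℕ → Op) (hA : ∀ k, ‖A k‖ ≤ 1) (hdA : ∀ k, ‖dA k‖ ≤ 1)
    (hdA' : ∀ k, dA (2 * k + 1) = 0) (m : ℕ) :
    ∀ p, ‖desf A dA (m + 1) (p + 1)‖ ≤ (((m + 2) / 2 : ℕ) : ℝ) * (m.choose p : ℝ) := by
  induction m with
  | zero =>
    intro p
    cases p with
    | zero => simpa [desf, esf] using hdA 0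
    | succ p => simp [desf, esf]
  | succ m ih =>
    intro p
    have h1 : ‖esf A (m + 1) p * dA (m + 1)‖ ≤
        (((m + 3) / 2 : ℕ) - ((m + 2) / 2 : ℕ) : ℝ) * ((m + 1).choose p : ℝ) := by
      rcases Nat.even_or_odd' m with ⟨q, rfl | rfl⟩
      · rw [hdA' q]
        have e1 : (2 * q + 3) / 2 = q + 1 := by omega
        have e2 : (2 * q + 2) / 2 = q + 1 := by omega
        rw [e1, e2]; simp
      · have e1 : (2 * q + 1 + 3) / 2 = q + 2 := by omega
        have e2 : (2 * q + 1 + 2) / 2 = q + 1 := by omega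
        rw [e1, e2]
        refine (norm_mul_le _ _).trans ?_
        have := mul_le_mul (esf_norm A hA (2 * q + 1 + 1) p) (hdA (2 * q + 1 + 1))
          (norm_nonneg _) (Nat.cast_nonneg _)
        refine this.trans (le_of_eq ?_)
        push_cast
        ring
    have h2 : ‖desf A dA (m + 1) (p + 1)‖ + ‖desf A dA (m + 1) p‖ ≤
        (((m + 2) / 2 : ℕ) : ℝ) * ((m + 1).choose p : ℝ) := by
      cases p with
      | zero =>
        rw [desf_zero]
        simpa using ih 0
      | succ p =>
        rw [Nat.choose_succ_succ']
        push_cast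
        have := ih p
        have := ih (p + 1)
        linarith
    have h3 : ‖desf A dA (m + 1) p * A (m + 1)‖ ≤ ‖desf A dA (m + 1) p‖ :=
      (norm_mul_le _ _).trans (mul_le_of_le_one_right (norm_nonneg _) (hA _))
    rw [desf]
    refine (norm_add_le _ _).trans ?_
    have h4 := norm_add_le (desf A dA (m + 1) p * A (m + 1)) (esf A (m + 1) p * dA (m + 1))
    have e : m + 1 + 2 = m + 3 := rfl
    rw [e]
    linarith

/-- the ordered product. -/
def oprod (A : ℕ → Op) (r t : ℂ) : ℕ → Op
  | 0 => 1
  | m + 1 => oprod A r t m * (r • (1 : Op) + t • A m)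

theorem oprod_eq (A : ℕ → Op) (r t : ℂ) (m : ℕ) :
    oprod A r t m = ∑ p ∈ Finset.range (m + 1), (r ^ (m - p) * t ^ p) • esf A m p := by
  induction m with
  | zero => simp [oprod, esf]
  | succ m ih =>
    rw [oprod, ih, Finset.sum_range_succ' _ (m + 1)]
    have e1 : ∀ p ∈ Finset.range (m + 1),
        (r ^ (m + 1 - (p + 1)) * t ^ (p + 1)) • esf A (m + 1) (p + 1) =
        (r ^ (m - p) * t ^ (p + 1)) • esf A m (p + 1) +
        (r ^ (m - p) * t ^ (p + 1)) • (esf A m p * A m) := by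
      intro p _
      rw [esf, smul_add, Nat.add_sub_add_right]
    rw [Finset.sum_congr rfl e1, Finset.sum_add_distrib]
    have e2 : ∑ p ∈ Finset.range (m + 1), (r ^ (m - p) * t ^ (p + 1)) • esf A m (p + 1) +
        (r ^ (m + 1) * t ^ 0) • esf A m 0 =
        r • ∑ p ∈ Finset.range (m + 1), (r ^ (m - p) * t ^ p) • esf A m p := by
      rw [Finset.sum_range_succ, esf_gt A m (m + 1) (by omega), smul_zero, add_zero,
        Finset.sum_range_succ' (fun p => (r ^ (m - p) * t ^ p) • esf A m p), smul_add,
        Finset.smul_sum]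
      congr 1
      · apply Finset.sum_congr rfl
        intro p hp
        rw [Finset.mem_range] at hp
        rw [smul_smul, ← mul_assoc, ← pow_succ']
        congr 3
        omega
      · rw [smul_smul, ← mul_assoc, ← pow_succ']
        rfl
    rw [mul_add, mul_smul_comm, mul_one, ← e2, Finset.sum_mul]
    have e3 : ∀ p ∈ Finset.range (m + 1),
        (r ^ (m - p) * t ^ p) • esf A m p * t • A m =
        (r ^ (m - p) * t ^ (p + 1)) • (esf A m p * A m) := by
      intro p _
      rw [smul_mul_smul_comm, mul_assoc, ← pow_succ]
    rw [Finset.sum_congr rfl e3]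
    have e4 : esf A (m + 1) 0 = esf A m 0 := rfl
    rw [e4, Nat.sub_zero]
    abel
/-! ### The half-step operators -/

/-- the permutation underlying the `k`-th half step. -/
def tau (k : ℤ) : Equiv.Perm ℤ where
  toFun i := if (i + k) % 2 = 0 then i - 1 else i + 1
  invFun i := if (i + k) % 2 = 0 then i - 1 else i + 1
  left_inv i := by dsimp only; split_ifs <;> omega
  right_inv i := by dsimp only; split_ifs <;> omega

theorem tau_apply (k i : ℤ) : tau k i = if (i + k) % 2 = 0 then i - 1 else i + 1 := rfl

/-- the weights of the `k`-th half step. -/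
def vv (α : ℂ) (k i : ℤ) : ℂ := if (i + k) % 2 = 0 then α ^ (-(k / 2 + 1)) else -α ^ (k / 2 + 1)

theorem vv_norm {α : ℂ} (hα : ‖α‖ = 1) (k i : ℤ) : ‖vv α k i‖ = 1 := by
  unfold vv
  split_ifs <;> simp [norm_zpow, hα]

/-- the family of half-step operators. -/
def IsHalf (α : ℂ) (A : ℤ → Op) : Prop := ∀ k j, A k (δ j) = vv α k j • δ (tau k j)

theorem coord_inner (ψ : Hqw) (i : ℤ) : inner ℂ (δ i) ψ = coord ψ i := by
  unfold δ coord
  rw [lp.inner_single_left]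
  simp

theorem half_adj {α : ℂ} (hα : ‖α‖ = 1) {A : ℤ → Op} (hA : IsHalf α A) (k : ℤ) :
    star (A k) = (-1 : ℂ) • A k := by
  have hα0 : α ≠ 0 := by intro h; simp [h] at hα
  have hc : (starRingEnd ℂ) α = α⁻¹ := (Complex.inv_eq_conj hα).symm
  apply op_ext
  intro j
  apply coord_ext
  intro i
  rw [ContinuousLinearMap.star_eq_adjoint, ← coord_inner, ContinuousLinearMap.adjoint_inner_right,
    ← inner_conj_symm, coord_inner, op_smul, hA, hA, coord_smul, coord_smul, coord_smul, coord_δ,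
    coord_δ, tau_apply, tau_apply]
  unfold vv
  by_cases h : (i + k) % 2 = 0
  · by_cases h' : (j + k) % 2 = 0
    · have h1 : j ≠ i - 1 := by omega
      have h2 : i ≠ j - 1 := by omega
      simp [h, h', h1, h2]
    · by_cases h1 : j = i - 1
      · have h2 : i = j + 1 := by omega
        rw [if_pos h, if_neg h', if_pos h, if_neg h', if_pos h1, if_pos h2]
        simp [map_zpow₀, hc]
      · have h2 : i ≠ j + 1 := by omega
        simp [h, h', h1, h2]
  · by_cases h' : (j + k) % 2 = 0
    · by_cases h1 : j = i + 1
      · have h2 : i = j - 1 := by omega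
        rw [if_neg h, if_pos h', if_neg h, if_pos h', if_pos h1, if_pos h2]
        simp [map_zpow₀, hc]
      · have h2 : i ≠ j - 1 := by omega
        simp [h, h', h1, h2]
    · have h1 : j ≠ i + 1 := by omega
      have h2 : i ≠ j + 1 := by omega
      simp [h, h', h1, h2]

theorem half_sq {α : ℂ} (hα : α ≠ 0) {A : ℤ → Op} (hA : IsHalf α A) (k : ℤ) :
    A k * A k = (-1 : ℂ) • (1 : Op) := by
  apply op_ext
  intro j
  rw [op_mul, op_smul, op_one, hA, map_smul, hA, smul_smul]
  have h1 : tau k (tau k j) = j := (tau k).left_inv j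
  rw [h1]
  congr 1
  rw [tau_apply]
  unfold vv
  by_cases h : (j + k) % 2 = 0
  · have h' : ¬ (j - 1 + k) % 2 = 0 := by omega
    rw [if_pos h, if_pos h, if_neg h', mul_neg, ← zpow_add₀ hα]
    simp
  · have h' : (j + 1 + k) % 2 = 0 := by omega
    rw [if_neg h, if_neg h, if_pos h', neg_mul, ← zpow_add₀ hα]
    simp

theorem half_norm {α : ℂ} (hα : ‖α‖ = 1) {A : ℤ → Op} (hA : IsHalf α A) (k : ℤ)
    (r t : ℝ) (h : r ^ 2 + t ^ 2 = 1) : ‖(r : ℂ) • (1 : Op) + (t : ℂ) • A k‖ ≤ 1 := by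
  have hα0 : α ≠ 0 := by intro h; simp [h] at hα
  set T : Op := (r : ℂ) • (1 : Op) + (t : ℂ) • A k with hT
  have h1 : star T * T = 1 := by
    rw [hT, star_add, star_smul, star_smul, star_one, half_adj hα hA]
    simp only [Complex.star_def, Complex.conj_ofReal, add_mul, mul_add, smul_mul_smul_comm,
      half_sq hα0 hA, smul_smul, mul_one, one_mul]
    have h' : (r : ℂ) ^ 2 + (t : ℂ) ^ 2 = 1 := by exact_mod_cast h
    calc _ = ((r : ℂ) ^ 2 + (t : ℂ) ^ 2) • (1 : Op) := by module
      _ = 1 := by rw [h', one_smul]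
  have h2 := CStarRing.norm_star_mul_self (x := T)
  rw [h1] at h2
  have h3 := norm_op_one
  rw [h2] at h3
  nlinarith [norm_nonneg T]

theorem half_band {α : ℂ} {A : ℤ → Op} (hA : IsHalf α A) (m : ℕ) :
    ∀ (p : ℕ) (i j : ℤ), (p : ℤ) < |i - j| →
      coord (esf (fun k : ℕ => A k) m p (δ j)) i = 0 := by
  induction m with
  | zero =>
    intro p i j h
    cases p with
    | zero =>
      simp only [esf]
      rw [op_one, coord_δ, if_neg]
      rintro rfl
      simp at h
    | succ p => rfl
  | succ m ih =>
    intro p i j h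
    cases p with
    | zero => exact ih 0 i j h
    | succ p =>
      simp only [esf]
      rw [op_add, coord_add, ih _ i j h, op_mul, hA, map_smul, coord_smul, ih p, mul_zero, zero_add]
      rw [tau_apply]
      push_cast at h
      split_ifs <;> grind

theorem esf_commute (a b : ℕ → Op) (S : Op) (h : ∀ k, S * a k = b k * S) (m : ℕ) :
    ∀ p, S * esf a m p = esf b m p * S := by
  induction m with
  | zero =>
    intro p
    cases p <;> simp [esf]
  | succ m ih =>
    intro p
    cases p with
    | zero => exact ih 0
    | succ p =>
      simp only [esf]
      rw [mul_add, add_mul, ih, ← mul_assoc, ih, mul_assoc, mul_assoc, h]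

theorem half_scalar {n : ℕ} (hn : 0 < n) {α : ℂ} (hprim : IsPrimitiveRoot α n)
    {A : ℤ → Op} (hA : IsHalf α A) (p : ℕ) (hp : p < n) :
    ∃ c : ℂ, esf (fun k : ℕ => A k) (2 * n) p = c • (1 : Op) := by
  have hα : ‖α‖ = 1 := hprim.norm'_eq_one hn.ne'
  have hα0 : α ≠ 0 := by intro h; simp [h] at hα
  obtain ⟨S, hS1, hS2, -⟩ := exists_wperm (Equiv.addRight (1 : ℤ)) (fun i => α ^ ((i + 1) / 2))
    (fun j => by rw [norm_zpow, hα, one_zpow])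
  obtain ⟨T, hT1, hT2, -⟩ := exists_wperm (Equiv.addRight (2 : ℤ)) (fun _ => 1) (fun j => by simp)
  simp only [Equiv.coe_addRight, one_smul, one_mul] at hS1 hS2 hT1 hT2
  have hSA : ∀ k, S * A k = A (k + 1) * S := by
    intro k
    apply op_ext
    intro j
    rw [op_mul, op_mul, hA, hS1, map_smul, map_smul, hA, hS1, smul_smul, smul_smul]
    rw [tau_apply, tau_apply]
    unfold vv
    by_cases h : (j + k) % 2 = 0
    · have h' : (j + 1 + (k + 1)) % 2 = 0 := by omega
      rw [if_pos h, if_pos h, if_pos h', if_pos h', ← zpow_add₀ hα0, ← zpow_add₀ hα0]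
      congr 2 <;> omega
    · have h' : ¬ (j + 1 + (k + 1)) % 2 = 0 := by omega
      rw [if_neg h, if_neg h, if_neg h', if_neg h', neg_mul, mul_neg, ← zpow_add₀ hα0,
        ← zpow_add₀ hα0]
      congr 3
      omega
  have hTA : ∀ k, T * A k = A k * T := by
    intro k
    apply op_ext
    intro j
    rw [op_mul, op_mul, hA, hT1, map_smul, hA, hT1]
    rw [tau_apply, tau_apply]
    unfold vv
    by_cases h : (j + k) % 2 = 0
    · have h' : (j + 2 + k) % 2 = 0 := by omega
      rw [if_pos h, if_pos h, if_pos h', if_pos h']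
      congr 2; omega
    · have h' : ¬ (j + 2 + k) % 2 = 0 := by omega
      rw [if_neg h, if_neg h, if_neg h', if_neg h']
      congr 2; omega
  have hper : A ((2 * n : ℕ) : ℤ) = A 0 := by
    apply op_ext
    intro j
    rw [hA, hA, tau_apply, tau_apply]
    unfold vv
    have e1 : (j + ((2 * n : ℕ) : ℤ)) % 2 = (j + 0) % 2 := by push_cast; omega
    have e2 : ((2 * n : ℕ) : ℤ) / 2 = n := by push_cast; omega
    have e3 : α ^ ((n : ℤ) + 1) = α ^ ((0 : ℤ) / 2 + 1) := by
      rw [zpow_add₀ hα0, zpow_natCast, hprim.pow_eq_one]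
      simp
    rw [e1, e2, zpow_neg, zpow_neg, e3]
  induction p with
  | zero => exact ⟨1, by rw [esf_zero, one_smul]⟩
  | succ p ih =>
    obtain ⟨c, hc⟩ := ih (by omega)
    set a : ℕ → Op := fun k : ℕ => A k with ha
    set b : ℕ → Op := fun k : ℕ => a (k + 1) with hb
    have hab : ∀ k, S * a k = b k * S := by
      intro k
      have := hSA k
      simp only [ha, hb]
      push_cast
      exact this
    have h1 := esf_commute a b S hab (2 * n) (p + 1)
    have h1' := esf_commute a b S hab (2 * n) p
    have h2 := esf_left a (2 * n) p
    rw [← hb] at h2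
    have h3 : esf a (2 * n + 1) (p + 1) = esf a (2 * n) (p + 1) + esf a (2 * n) p * a (2 * n) := rfl
    have h4 : a (2 * n) = a 0 := hper
    set Q := esf a (2 * n) (p + 1) with hQ
    have hSQ : S * Q = Q * S := by
      have e : esf b (2 * n) (p + 1) = Q + esf a (2 * n) p * a 0 - a 0 * esf b (2 * n) p := by
        rw [← h4, ← h3, h2, h4]; abel
      rw [h1, e, sub_mul, add_mul, mul_assoc (a 0), ← h1', hc]
      simp
    have hTQ : T * Q = Q * T := esf_commute a a T (fun k => hTA k) (2 * n) (p + 1)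
    have hq1 : ∀ i j, α ^ ((i + 1) / 2) * coord (Q (δ j)) i =
        α ^ ((j + 1) / 2) * coord (Q (δ (j + 1))) (i + 1) := by
      intro i j
      rw [← hS2, ← op_mul, hSQ, op_mul, hS1, map_smul, coord_smul]
    have hq2 : ∀ i j, coord (Q (δ j)) i = coord (Q (δ (j + 2))) (i + 2) := by
      intro i j
      rw [← hT2, ← op_mul, hTQ, op_mul, hT1]
    have hq3 : ∀ i j, i ≠ j → coord (Q (δ j)) i = 0 := by
      intro i j hij
      by_cases hlt : ((p + 1 : ℕ) : ℤ) < |i - j|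
      · exact half_band hA (2 * n) (p + 1) i j hlt
      · by_contra hne
        have e1 := hq1 i j
        have e2 := hq1 (i + 1) (j + 1)
        have e3 := hq2 i j
        have e4 : α ^ i * coord (Q (δ j)) i = α ^ j * coord (Q (δ j)) i := by
          have f1 : ∀ i : ℤ, α ^ ((i + 1) / 2) * α ^ ((i + 1 + 1) / 2) = α ^ i * α := by
            intro i
            rw [← zpow_add₀ hα0, ← zpow_add_one₀ hα0]
            congr 1; omega
          rw [add_assoc i 1 1, add_assoc j 1 1] at e2
          norm_num only at e2
          rw [← e3] at e2
          have f2 := f1 i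
          have f3 := f1 j
          rw [add_assoc _ 1 1] at f2 f3
          norm_num only at f2 f3
          have : α * (α ^ i * coord (Q (δ j)) i) = α * (α ^ j * coord (Q (δ j)) i) := by
            linear_combination (-coord (Q (δ j)) i) * f2 + coord (Q (δ j)) i * f3 +
              α ^ ((i + 2) / 2) * e1 + α ^ ((j + 1) / 2) * e2
          exact mul_left_cancel₀ hα0 this
        have e5 : α ^ (i - j) = 1 := by
          rw [zpow_sub₀ hα0, mul_right_cancel₀ hne e4]
          exact div_self (zpow_ne_zero _ hα0)
        have e6 := (hprim.zpow_eq_one_iff_dvd _).1 e5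
        have e7 := Int.le_of_dvd (abs_pos.2 (sub_ne_zero.2 hij)) ((dvd_abs _ _).2 e6)
        push_cast at hlt
        omega
    have hq4 : ∀ j, coord (Q (δ (j + 1))) (j + 1) = coord (Q (δ j)) j := by
      intro j
      exact (mul_left_cancel₀ (zpow_ne_zero _ hα0) (hq1 j j)).symm
    have hq5 : ∀ j, coord (Q (δ j)) j = coord (Q (δ 0)) 0 := by
      intro j
      induction j using Int.induction_on with
      | zero => rfl
      | succ i ih => rw [hq4, ih]
      | pred i ih => rw [← ih, ← hq4, sub_add_cancel]
    refine ⟨coord (Q (δ 0)) 0, ?_⟩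
    apply op_ext
    intro j
    apply coord_ext
    intro i
    rw [op_smul, op_one, coord_smul, coord_δ]
    split_ifs with h
    · rw [h, hq5, mul_one]
    · rw [hq3 i j h, mul_zero]

/-! ### Relating the walk to half steps -/

theorem half_walk {n : ℕ} (hn : 0 < n) {α : ℂ} (hprim : IsPrimitiveRoot α n)
    {A : ℤ → Op} (hA : IsHalf α A) {B C D : Op} (hB : IsB B) (hC : IsC C) (hD : IsDn α D) (t : ℝ) :
    (D * Ut t B C) ^ n =
      oprod (fun k : ℕ => A k) ((Real.sqrt (1 - t ^ 2) : ℝ) : ℂ) (t : ℂ) (2 * n) := by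
  have hα : ‖α‖ = 1 := hprim.norm'_eq_one hn.ne'
  have hα0 : α ≠ 0 := by intro h; simp [h] at hα
  set r : ℂ := ((Real.sqrt (1 - t ^ 2) : ℝ) : ℂ) with hr
  have hparity : ∀ j : ℤ, (∃ i, j = 2 * i) ∨ (∃ i, j = 2 * i + 1) := fun j => by
    rcases Int.even_or_odd' j with ⟨i, h | h⟩
    · exact Or.inl ⟨i, h⟩
    · exact Or.inr ⟨i, h⟩
  have hm2e : ∀ i : ℤ, A (-2) (δ (2 * i)) = δ (2 * i - 1) := by
    intro i
    rw [hA, tau_apply]; unfold vv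
    have h : (2 * i + -2) % 2 = 0 := by omega
    rw [if_pos h, if_pos h]; norm_num
  have hm2o : ∀ i : ℤ, A (-2) (δ (2 * i + 1)) = (-1 : ℂ) • δ (2 * i + 2) := by
    intro i
    rw [hA, tau_apply]; unfold vv
    have h : ¬ (2 * i + 1 + -2) % 2 = 0 := by omega
    rw [if_neg h, if_neg h, add_assoc]; norm_num
  have hm1e : ∀ i : ℤ, A (-1) (δ (2 * i)) = (-1 : ℂ) • δ (2 * i + 1) := by
    intro i
    rw [hA, tau_apply]; unfold vv
    have h : ¬ (2 * i + -1) % 2 = 0 := by omega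
    rw [if_neg h, if_neg h]; norm_num
  have hm1o : ∀ i : ℤ, A (-1) (δ (2 * i + 1)) = δ (2 * i) := by
    intro i
    rw [hA, tau_apply]; unfold vv
    have h : (2 * i + 1 + -1) % 2 = 0 := by omega
    rw [if_pos h, if_pos h]; norm_num
  have hBA : B = A (-2) + A (-1) := by
    apply op_ext
    intro j
    rw [op_add, hB]
    rcases hparity j with ⟨i, rfl | rfl⟩ | ⟨i, rfl | rfl⟩
    · rw [hm2e, hm1e]; module
    · rw [hm2o, hm1o, add_sub_cancel_right, add_assoc, one_add_one_eq_two]; module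
  have hCA : C = A (-2) * A (-1) := by
    apply op_ext
    intro j
    rw [op_mul]
    rcases hparity j with ⟨i, rfl | rfl⟩ | ⟨i, rfl | rfl⟩
    · rw [hm1e, map_smul, hm2o, (hC i).1, smul_smul]; norm_num
    · rw [hm1o, hm2e, (hC i).2]
  have hU : Ut t B C = (r • (1 : Op) + (t : ℂ) • A (-2)) * (r • (1 : Op) + (t : ℂ) • A (-1)) := by
    unfold Ut
    rw [hBA, hCA]
    push_cast
    rw [← hr]
    simp only [add_mul, mul_add, smul_mul_smul_comm, mul_one, one_mul]
    module
  have hDA : ∀ k, D * A k = A (k + 2) * D := by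
    intro k
    apply op_ext
    intro j
    rw [op_mul, op_mul, hA, hD, map_smul, map_smul, hA, hD, smul_smul, smul_smul]
    rw [tau_apply, tau_apply]
    unfold vv
    by_cases h : (j + k) % 2 = 0
    · have h' : (j + (k + 2)) % 2 = 0 := by omega
      rw [if_pos h, if_pos h, if_pos h', if_pos h', ← zpow_add₀ hα0, ← zpow_add₀ hα0]
      congr 2; omega
    · have h' : ¬ (j + (k + 2)) % 2 = 0 := by omega
      rw [if_neg h, if_neg h, if_neg h', if_neg h', neg_mul, mul_neg, ← zpow_add₀ hα0,
        ← zpow_add₀ hα0]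
      congr 3; omega
  have hDf : ∀ (m : ℕ) k, D ^ m * (r • (1 : Op) + (t : ℂ) • A k) =
      (r • (1 : Op) + (t : ℂ) • A (k + 2 * m)) * D ^ m := by
    intro m
    induction m with
    | zero => intro k; simp
    | succ m ih =>
      intro k
      have h1 : D * (r • (1 : Op) + (t : ℂ) • A k) =
          (r • (1 : Op) + (t : ℂ) • A (k + 2)) * D := by
        rw [mul_add, add_mul, mul_smul_comm, mul_smul_comm, smul_mul_assoc, smul_mul_assoc, hDA,
          mul_one, one_mul]
      rw [pow_succ, mul_assoc, h1, ← mul_assoc, ih, mul_assoc]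
      have e : k + 2 + 2 * (m : ℤ) = k + 2 * ((m + 1 : ℕ) : ℤ) := by push_cast; ring
      rw [e]
  have hpow : ∀ m : ℕ, (D * Ut t B C) ^ m = oprod (fun k : ℕ => A k) r (t : ℂ) (2 * m) * D ^ m := by
    intro m
    induction m with
    | zero => simp [oprod]
    | succ m ih =>
      have e1 : (-2 : ℤ) + 2 * ((m + 1 : ℕ) : ℤ) = ((2 * m : ℕ) : ℤ) := by push_cast; ring
      have e2 : (-1 : ℤ) + 2 * ((m + 1 : ℕ) : ℤ) = ((2 * m + 1 : ℕ) : ℤ) := by push_cast; ring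
      have e3 : oprod (fun k : ℕ => A k) r (t : ℂ) (2 * (m + 1)) =
        oprod (fun k : ℕ => A k) r (t : ℂ) (2 * m) *
          (r • (1 : Op) + (t : ℂ) • A ((2 * m : ℕ) : ℤ)) *
          (r • (1 : Op) + (t : ℂ) • A ((2 * m + 1 : ℕ) : ℤ)) := rfl
      rw [pow_succ, ih, e3, mul_assoc, ← mul_assoc (D ^ m), ← pow_succ, hU, ← mul_assoc (D ^ (m + 1)),
        hDf, e1, mul_assoc _ (D ^ (m + 1)), hDf, e2]
      simp only [mul_assoc]
  rw [hpow]
  have hDn : ∀ (m : ℕ) j, (D ^ m) (δ j) = (α ^ j) ^ m • δ j := by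
    intro m j
    induction m with
    | zero => simp
    | succ m ih => rw [pow_succ', op_mul, ih, map_smul, hD, smul_smul, pow_succ]
  have hD1 : D ^ n = 1 := by
    apply op_ext
    intro j
    rw [hDn, op_one, ← zpow_natCast, zpow_comm, zpow_natCast, hprim.pow_eq_one, one_zpow, one_smul]
  rw [hD1, mul_one]

theorem oprod_norm {α : ℂ} (hα : ‖α‖ = 1) {A : ℤ → Op} (hA : IsHalf α A)
    (r t : ℝ) (h : r ^ 2 + t ^ 2 = 1) (m : ℕ) : ‖oprod (fun k : ℕ => A k) (r : ℂ) (t : ℂ) m‖ ≤ 1 := by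
  induction m with
  | zero => exact norm_op_one
  | succ m ih =>
    rw [oprod]
    exact (norm_mul_le _ _).trans (mul_le_one₀ ih (norm_nonneg _) (half_norm hα hA _ r t h))

theorem exists_half {α : ℂ} (hα : ‖α‖ = 1) {x : ℤ → ℝ} (hx : IsPos x) :
    ∃ A dA : ℤ → Op, IsHalf α A ∧ (∀ k, ‖A k‖ ≤ 1) ∧ (∀ k, IsXComm x (A k) (dA k)) ∧
      (∀ k, ‖dA k‖ ≤ 1) ∧ ∀ k, dA (2 * k + 1) = 0 := by
  have hpar : ∀ j : ℤ, x j = |((j / 2 : ℤ) : ℝ)| := by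
    intro j
    rcases Int.even_or_odd' j with ⟨i, rfl | rfl⟩
    · rw [(hx i).1]; congr 2; omega
    · rw [(hx i).2]; congr 2; omega
  have hdx : ∀ k j, |x (tau k j) - x j| ≤ 1 := by
    intro k j
    rw [hpar, hpar]
    refine (abs_abs_sub_abs_le_abs_sub _ _).trans ?_
    have : |tau k j / 2 - j / 2| ≤ 1 := by
      rw [tau_apply, abs_le]
      split_ifs <;> constructor <;> omega
    exact_mod_cast this
  have hodd : ∀ k j, x (tau (2 * k + 1) j) = x j := by
    intro k j
    rw [hpar, hpar, tau_apply]
    congr 2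
    split_ifs <;> omega
  have h1 := fun k => exists_wperm (tau k) (vv α k) (fun j => (vv_norm hα k j).le)
  have h2 := fun k => exists_wperm (tau k)
    (fun j => ((x (tau k j) - x j : ℝ) : ℂ) * vv α k j) (fun j => by
      rw [norm_mul, vv_norm hα, mul_one, Complex.norm_real]
      exact hdx k j)
  choose A hA1 hA2 hA3 using h1
  choose dA hd1 hd2 hd3 using h2
  refine ⟨A, dA, hA1, hA3, ?_, hd3, ?_⟩
  · intro k i j
    rw [hd1, hA1, coord_smul, coord_smul, coord_δ]
    split_ifs with h
    · rw [h]; ring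
    · simp
  · intro k
    apply op_ext
    intro j
    rw [hd1, hodd]
    simp
theorem admissible_prim {n : ℕ} (hn : 0 < n) {α : ℂ} (hα : IsAdmissible n α) :
    IsPrimitiveRoot α n := by
  obtain ⟨-, k, -, hk, rfl⟩ := hα
  convert Complex.isPrimitiveRoot_exp_of_coprime k n hn.ne' hk using 2
  push_cast
  ring

theorem stmt5_aux (n : ℕ) (hn : 0 < n) (r t : ℝ) (hr0 : 0 ≤ r) (hr1 : r ≤ 1) (ht0 : 0 ≤ t)
    (ht1 : t ≤ 1) (E : ℕ → Op) (h0 : ∀ p < n, E p = 0)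
    (hE : ∀ p, ‖E (p + 1)‖ ≤ (n : ℝ) * ((2 * n - 1).choose p : ℝ)) :
    ‖∑ p ∈ Finset.range (2 * n + 1), ((r : ℂ) ^ (2 * n - p) * (t : ℂ) ^ p) • E p‖ ≤
      n * (1 / 2 * (4 * t) ^ n) := by
  rw [Finset.sum_range_succ', h0 0 hn, smul_zero, add_zero]
  have hb : ∀ p ∈ Finset.range (2 * n),
      ‖((r : ℂ) ^ (2 * n - (p + 1)) * (t : ℂ) ^ (p + 1)) • E (p + 1)‖ ≤
      (n * t ^ n) * ((2 * n - 1).choose p : ℝ) := by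
    intro p _
    by_cases hp : p + 1 < n
    · rw [h0 _ hp, smul_zero, norm_zero]; positivity
    · rw [norm_smul, norm_mul, norm_pow, norm_pow, Complex.norm_real, Complex.norm_real,
        Real.norm_of_nonneg hr0, Real.norm_of_nonneg ht0]
      calc r ^ (2 * n - (p + 1)) * t ^ (p + 1) * ‖E (p + 1)‖
          ≤ 1 * t ^ n * ((n : ℝ) * ((2 * n - 1).choose p : ℝ)) := by
            have h1 : r ^ (2 * n - (p + 1)) ≤ 1 := pow_le_one₀ hr0 hr1
            have h2 : t ^ (p + 1) ≤ t ^ n := pow_le_pow_of_le_one ht0 ht1 (by omega)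
            exact mul_le_mul (mul_le_mul h1 h2 (by positivity) zero_le_one) (hE p)
              (norm_nonneg _) (by positivity)
        _ = _ := by ring
  refine (norm_sum_le _ _).trans ((Finset.sum_le_sum hb).trans (le_of_eq ?_))
  rw [← Finset.mul_sum]
  obtain ⟨m, rfl⟩ : ∃ m, n = m + 1 := ⟨n - 1, by omega⟩
  have e1 : 2 * (m + 1) - 1 = 2 * m + 1 := by omega
  have e2 : 2 * (m + 1) = 2 * m + 1 + 1 := by omega
  rw [e1, e2, ← Nat.cast_sum, Nat.sum_range_choose]
  push_cast
  rw [mul_pow, show (4 : ℝ) = 2 ^ 2 by norm_num, ← pow_mul]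
  ring

/-- for every `n, k ∈ ℤ⁺`, every admissible `α` and `t ∈ [0,1]`,
`(1/(nk))‖[X, U_{t,n}^{nk}]‖ ≤ (3/4)(4t)^n`. -/
theorem stmt5 (n : ℕ) (hn : 0 < n) (α : ℂ) (hα : IsAdmissible n α)
    (t : ℝ) (ht : t ∈ Set.Icc (0 : ℝ) 1)
    (B C D : Op) (hB : IsB B) (hC : IsC C) (hD : IsDn α D)
    (x : ℤ → ℝ) (hx : IsPos x)
    (k : ℕ) (hk : 0 < k)
    (K : Op) (hK : IsXComm x ((D * Ut t B C) ^ (n * k)) K) :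
    (1 / ((n * k : ℕ) : ℝ)) * ‖K‖ ≤ (3 / 4) * (4 * t) ^ n := by
  have hprim := admissible_prim hn hα
  have hα1 : ‖α‖ = 1 := hprim.norm'_eq_one hn.ne'
  obtain ⟨A, dA, hA, hA1, hcomm, hd1, hd2⟩ := exists_half hα1 hx
  set r : ℝ := Real.sqrt (1 - t ^ 2) with hr
  have ht0 := ht.1
  have ht1 := ht.2
  have hr0 : 0 ≤ r := Real.sqrt_nonneg _
  have hrsq : r ^ 2 + t ^ 2 = 1 := by
    rw [hr, Real.sq_sqrt (by nlinarith)]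
    ring
  have hr1 : r ≤ 1 := by nlinarith
  have hW := half_walk hn hprim hA hB hC hD t
  rw [← hr] at hW
  set a : ℕ → Op := fun k : ℕ => A k with ha
  set da : ℕ → Op := fun k : ℕ => dA k with hda
  have hde := desf_comm x a da (fun k => hcomm k) (2 * n)
  have hE0 : ∀ p < n, desf a da (2 * n) p = 0 := by
    intro p hp
    obtain ⟨c, hc⟩ := half_scalar hn hprim hA p hp
    have h1 := hde p
    rw [hc] at h1
    have h2 := isXComm_smul c (isXComm_one x)
    rw [smul_zero] at h2
    exact isXComm_unique h1 h2
  have hE : ∀ p, ‖desf a da (2 * n) (p + 1)‖ ≤ (n : ℝ) * ((2 * n - 1).choose p : ℝ) := by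
    intro p
    have h1 := desf_norm a da (fun k => hA1 k) (fun k => hd1 k)
      (fun k => by simp only [hda]; push_cast; exact hd2 k) (2 * n - 1) p
    have e1 : 2 * n - 1 + 1 = 2 * n := by omega
    have e2 : (2 * n - 1 + 2) / 2 = n := by omega
    rwa [e1, e2] at h1
  have hK1 : IsXComm x ((D * Ut t B C) ^ n)
      (∑ p ∈ Finset.range (2 * n + 1), ((r : ℂ) ^ (2 * n - p) * (t : ℂ) ^ p) • desf a da (2 * n) p) := by
    rw [hW, oprod_eq]
    exact isXComm_sum _ _ _ (fun p => isXComm_smul _ (hde p))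
  have hKn := stmt5_aux n hn r t hr0 hr1 ht0 ht1 (desf a da (2 * n)) hE0 hE
  have hn1 : ‖(D * Ut t B C) ^ n‖ ≤ 1 := by
    rw [hW]
    exact oprod_norm hα1 hA r t hrsq (2 * n)
  obtain ⟨K', hK', hKb⟩ := isXComm_pow hK1 hn1 k
  rw [pow_mul] at hK
  rw [isXComm_unique hK hK']
  have hnp : (0 : ℝ) < n := by exact_mod_cast hn
  have hkp : (0 : ℝ) < k := by exact_mod_cast hk
  have hpos : (0 : ℝ) ≤ (4 * t) ^ n := by positivity
  push_cast
  rw [one_div, inv_mul_le_iff₀ (by positivity)]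
  calc ‖K'‖ ≤ k * (n * (1 / 2 * (4 * t) ^ n)) := hKb.trans (by gcongr)
    _ ≤ k * (n * (3 / 4 * (4 * t) ^ n)) := by
      have h1 : 1 / 2 * (4 * t) ^ n ≤ 3 / 4 * (4 * t) ^ n := by linarith
      exact mul_le_mul_of_nonneg_left (mul_le_mul_of_nonneg_left h1 hnp.le) hkp.le
    _ = _ := by ring
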